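/- arXiv:2208.12476 — 3 statements merged into one kernel-verified Lean document; each statement's English description precedes it below -/
import Mathlib

section
/- Let N ≥ 1 and let A be an N×N matrix with entries in {0,1}, regarded as an integer matrix, and assume A is irreducible and not a permutation matrix. Then the sequence of abelian groups 0 → {x ∈ Ker(I−A) : s_A(x) = 0} → Ker(I−A) → ℤ → ℤ^{N+1}/(I−A_1)ℤ^{N+1} → ℤ^N/(I−A)ℤ^N → 0 is exact, where the first map is the inclusion, the second map is the restriction of s_A to Ker(I−A), the third map is ι_{A_1}, and the fourth map is q_{A_1}. -/
open Matrix

noncomputable section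

/-- `A` has entries in `{0,1}`. -/
def ZeroOneEntries {N : ℕ} (A : Matrix (Fin N) (Fin N) ℤ) : Prop :=
  ∀ i j, A i j = 0 ∨ A i j = 1

/-- `A` is irreducible: for all `i j` there is `m ≥ 1` with `(A^m) i j ≥ 1`. -/
def IsIrreducibleMatrix {N : ℕ} (A : Matrix (Fin N) (Fin N) ℤ) : Prop :=
  ∀ i j, ∃ m : ℕ, 1 ≤ m ∧ 1 ≤ (A ^ m) i j

/-- `A` is a permutation matrix: every row and column has exactly one nonzero entry. -/
def IsPermutationMatrix {N : ℕ} (A : Matrix (Fin N) (Fin N) ℤ) : Prop :=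
  (∀ i, ∃! j, A i j ≠ 0) ∧ (∀ j, ∃! i, A i j ≠ 0)

/-- The matrix `R₁` whose first row is `(1,…,1)` and whose other rows vanish. -/
def R1 (N : ℕ) [NeZero N] : Matrix (Fin N) (Fin N) ℤ :=
  Matrix.of fun i _ => if i = 0 then 1 else 0

/-- `Â = A + R₁ - A·R₁`. -/
def Ahat {N : ℕ} [NeZero N] (A : Matrix (Fin N) (Fin N) ℤ) : Matrix (Fin N) (Fin N) ℤ :=
  A + R1 N - A * R1 N

/-- The subgroup `Mℤ^N = {Mx : x ∈ ℤ^N}` of `ℤ^N`. -/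
abbrev colSpan {N : ℕ} (M : Matrix (Fin N) (Fin N) ℤ) : Submodule ℤ (Fin N → ℤ) :=
  LinearMap.range M.mulVecLin

/-- The quotient group `ℤ^N / Mℤ^N`. -/
abbrev MQuot {N : ℕ} (M : Matrix (Fin N) (Fin N) ℤ) := (Fin N → ℤ) ⧸ colSpan M

/-- `s_A : ℤ^N → ℤ`, sum of coordinates. -/
def sA (N : ℕ) : (Fin N → ℤ) →ₗ[ℤ] ℤ := ∑ i : Fin N, LinearMap.proj i

lemma sA_apply {N : ℕ} (x : Fin N → ℤ) : sA N x = ∑ i, x i := by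
  simp [sA]

/-- `e₁ = (1,0,…,0) ∈ ℤ^N`. -/
def e1 (N : ℕ) [NeZero N] : Fin N → ℤ := Pi.single 0 1

/-- `i₁ : ℤ → ℤ^N`, `m ↦ (m,0,…,0)`. -/
def i1 (N : ℕ) [NeZero N] : ℤ →ₗ[ℤ] (Fin N → ℤ) :=
  LinearMap.toSpanSingleton ℤ _ (e1 N)

/-- `j_A : ℤ^N → ℤ^N`,
`(l₁,…,l_N) ↦ (-∑_{i=2}^N l_i, l₂, …, l_N)`. -/
def jA (N : ℕ) [NeZero N] : (Fin N → ℤ) →ₗ[ℤ] (Fin N → ℤ) where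
  toFun l := fun i => if i = 0 then -∑ k ∈ Finset.univ.erase 0, l k else l i
  map_add' a b := by
    funext i
    by_cases h : i = 0
    · simp only [h, reduceIte, Pi.add_apply, Finset.sum_add_distrib]
      ring
    · simp [h]
  map_smul' c a := by
    funext i
    by_cases h : i = 0 <;>
      simp [h, Finset.mul_sum, smul_eq_mul, mul_neg, mul_sub]

/-- The matrix `A₁` of size `N+1`, with first row `(1,…,1)`, first column `(1,0,…,0)ᵗ`,
and lower-right `N×N` block `A`. -/
def A1 {N : ℕ} (A : Matrix (Fin N) (Fin N) ℤ) : Matrix (Fin (N+1)) (Fin (N+1)) ℤ :=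
  Matrix.of fun i j =>
    Fin.cases 1 (fun i' => Fin.cases 0 (fun j' => A i' j') j) i

/-- `ℤ^N → ℤ^{N+1}`, `x ↦ (0, x)`. -/
def ext0 {N : ℕ} : (Fin N → ℤ) →ₗ[ℤ] (Fin (N+1) → ℤ) where
  toFun x := Fin.cons 0 x
  map_add' a b := by
    funext i
    refine Fin.cases ?_ (fun i' => ?_) i <;> simp
  map_smul' c a := by
    funext i
    refine Fin.cases ?_ (fun i' => ?_) i <;> simp

/-- `ℤ^{N+1} → ℤ^N`, deleting the first coordinate. -/
def tailL {N : ℕ} : (Fin (N+1) → ℤ) →ₗ[ℤ] (Fin N → ℤ) :=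
  LinearMap.funLeft ℤ ℤ Fin.succ

lemma sA_e1 {N : ℕ} [NeZero N] : sA N (e1 N) = 1 := by
  simp [sA_apply, e1, Pi.single_apply]

lemma R1_mulVec {N : ℕ} [NeZero N] (x : Fin N → ℤ) :
    (R1 N).mulVec x = (sA N x) • e1 N := by
  funext i
  by_cases h : i = 0 <;>
    simp [R1, e1, Matrix.mulVec, dotProduct, sA_apply, Pi.single_apply, h]

lemma jA_eq' {N : ℕ} [NeZero N] (x : Fin N → ℤ) :
    jA N x = x - (sA N x) • e1 N := by
  funext i
  by_cases h : i = 0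
  · subst h
    simp only [jA, LinearMap.coe_mk, AddHom.coe_mk, reduceIte, Pi.sub_apply, Pi.smul_apply,
      smul_eq_mul, sA_apply, e1, Pi.single_eq_same, mul_one]
    rw [← Finset.add_sum_erase _ x (Finset.mem_univ 0)]
    ring
  · simp [jA, e1, Pi.single_apply, h]

lemma jA_eq_mulVec {N : ℕ} [NeZero N] (x : Fin N → ℤ) :
    jA N x = (1 - R1 N).mulVec x := by
  rw [jA_eq', Matrix.sub_mulVec, Matrix.one_mulVec, R1_mulVec]

lemma one_sub_Ahat {N : ℕ} [NeZero N] (A : Matrix (Fin N) (Fin N) ℤ) :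
    1 - Ahat A = (1 - A) * (1 - R1 N) := by
  unfold Ahat
  noncomm_ring

lemma colSpan_Ahat_le {N : ℕ} [NeZero N] (A : Matrix (Fin N) (Fin N) ℤ) :
    colSpan (1 - Ahat A) ≤ colSpan (1 - A) := by
  rintro _ ⟨x, rfl⟩
  refine ⟨(1 - R1 N).mulVec x, ?_⟩
  rw [mulVecLin_apply, mulVecLin_apply, one_sub_Ahat, ← Matrix.mulVec_mulVec]

/-- `q̂_A : ℤ^N/(I-Â)ℤ^N → ℤ^N/(I-A)ℤ^N`, induced by the identity map of `ℤ^N`. -/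
def qHat {N : ℕ} [NeZero N] (A : Matrix (Fin N) (Fin N) ℤ) :
    MQuot (1 - Ahat A) →ₗ[ℤ] MQuot (1 - A) :=
  Submodule.liftQ _ (colSpan (1 - A)).mkQ
    (by simpa [Submodule.ker_mkQ] using colSpan_Ahat_le A)

/-- `ι̂_A : ℤ → ℤ^N/(I-Â)ℤ^N`, `m ↦ [(I-A)(m·e₁)]`. -/
def iotaHat {N : ℕ} [NeZero N] (A : Matrix (Fin N) (Fin N) ℤ) :
    ℤ →ₗ[ℤ] MQuot (1 - Ahat A) :=
  (colSpan (1 - Ahat A)).mkQ ∘ₗ (1 - A).mulVecLin ∘ₗ i1 N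

lemma e1_mem_kerHat {N : ℕ} [NeZero N] (A : Matrix (Fin N) (Fin N) ℤ) :
    e1 N ∈ LinearMap.ker (1 - Ahat A).mulVecLin := by
  rw [LinearMap.mem_ker, mulVecLin_apply, one_sub_Ahat, ← Matrix.mulVec_mulVec]
  have : (1 - R1 N).mulVec (e1 N) = 0 := by
    rw [Matrix.sub_mulVec, Matrix.one_mulVec, R1_mulVec, sA_e1, one_smul, sub_self]
  rw [this, Matrix.mulVec_zero]

lemma jA_mem_ker {N : ℕ} [NeZero N] (A : Matrix (Fin N) (Fin N) ℤ) (x : Fin N → ℤ)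
    (hx : x ∈ LinearMap.ker (1 - Ahat A).mulVecLin) :
    jA N x ∈ LinearMap.ker (1 - A).mulVecLin := by
  rw [LinearMap.mem_ker, mulVecLin_apply] at *
  rw [jA_eq_mulVec, Matrix.mulVec_mulVec, ← one_sub_Ahat]
  exact hx

lemma sA_jA {N : ℕ} [NeZero N] (x : Fin N → ℤ) : sA N (jA N x) = 0 := by
  rw [jA_eq', map_sub, LinearMap.map_smul, sA_e1, smul_eq_mul, mul_one, sub_self]

lemma jA_e1 {N : ℕ} [NeZero N] : jA N (e1 N) = 0 := by
  rw [jA_eq', sA_e1, one_smul, sub_self]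

lemma tailL_key {N : ℕ} (A : Matrix (Fin N) (Fin N) ℤ) (x : Fin (N+1) → ℤ) :
    tailL ((1 - A1 A).mulVec x) = (1 - A).mulVec (tailL x) := by
  funext i
  simp only [tailL, LinearMap.funLeft_apply, Function.comp, Matrix.mulVec, dotProduct,
    Matrix.sub_apply, Matrix.one_apply, A1, Matrix.of_apply, Fin.cases_succ,
    sub_mul, Finset.sum_sub_distrib]
  congr 1
  · rw [Fin.sum_univ_succ]
    simp [Fin.succ_ne_zero, Fin.succ_inj]
  · rw [Fin.sum_univ_succ]
    simp

/-- `ι_{A₁} : ℤ → ℤ^{N+1}/(I-A₁)ℤ^{N+1}`, `m ↦ [(0, (I-A)(m·e₁))]`. -/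
def iotaA1 {N : ℕ} [NeZero N] (A : Matrix (Fin N) (Fin N) ℤ) :
    ℤ →ₗ[ℤ] MQuot (1 - A1 A) :=
  (colSpan (1 - A1 A)).mkQ ∘ₗ ext0 ∘ₗ (1 - A).mulVecLin ∘ₗ i1 N

/-- `q_{A₁} : ℤ^{N+1}/(I-A₁)ℤ^{N+1} → ℤ^N/(I-A)ℤ^N`, induced by deleting the
first coordinate. -/
def qA1 {N : ℕ} (A : Matrix (Fin N) (Fin N) ℤ) :
    MQuot (1 - A1 A) →ₗ[ℤ] MQuot (1 - A) :=
  Submodule.liftQ _ ((colSpan (1 - A)).mkQ ∘ₗ tailL) (by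
    rintro _ ⟨x, rfl⟩
    simp only [LinearMap.mem_ker, LinearMap.comp_apply, mulVecLin_apply]
    rw [tailL_key]
    exact (Submodule.Quotient.mk_eq_zero _).2 ⟨tailL x, rfl⟩)


/-- The kernel `Ker M = {x ∈ ℤ^N : Mx = 0}`. -/
abbrev kerM {N : ℕ} (M : Matrix (Fin N) (Fin N) ℤ) : Submodule ℤ (Fin N → ℤ) :=
  LinearMap.ker M.mulVecLin

/-- The restriction of `s_A` to `Ker(I-A)`. -/
def sRes {N : ℕ} [NeZero N] (A : Matrix (Fin N) (Fin N) ℤ) :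
    kerM (1 - A) →ₗ[ℤ] ℤ :=
  (sA N).comp (kerM (1 - A)).subtype

/-- The inclusion `{x ∈ Ker(I-A) : s_A(x) = 0} → Ker(I-A)`. -/
def inclKer {N : ℕ} (A : Matrix (Fin N) (Fin N) ℤ) :
    ↥(kerM (1 - A) ⊓ LinearMap.ker (sA N)) →ₗ[ℤ] kerM (1 - A) :=
  Submodule.inclusion inf_le_left

lemma one_sub_A1_mulVec {N : ℕ} (A : Matrix (Fin N) (Fin N) ℤ) (y : Fin (N + 1) → ℤ) :
    (1 - A1 A).mulVec y = Fin.cons (-sA N (tailL y)) ((1 - A).mulVec (tailL y)) := by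
  funext i
  refine Fin.cases ?_ (fun i' => ?_) i
  · simp [sA_apply, tailL, LinearMap.funLeft_apply, Matrix.mulVec, dotProduct, A1,
      Fin.sum_univ_succ, Matrix.one_apply, (Fin.succ_ne_zero _).symm]
  · exact congrFun (tailL_key A y) i'

lemma cons_mem_colSpan_one_sub_A1 {N : ℕ} (A : Matrix (Fin N) (Fin N) ℤ) (a : ℤ)
    (v : Fin N → ℤ) :
    (Fin.cons a v : Fin (N + 1) → ℤ) ∈ colSpan (1 - A1 A) ↔
      ∃ w : Fin N → ℤ, -sA N w = a ∧ (1 - A).mulVec w = v := by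
  constructor
  · rintro ⟨y, hy⟩
    rw [mulVecLin_apply, one_sub_A1_mulVec] at hy
    exact ⟨tailL y, Fin.cons_injective2 hy⟩
  · rintro ⟨w, rfl, rfl⟩
    refine ⟨Fin.cons 0 w, ?_⟩
    have hw : tailL (Fin.cons 0 w : Fin (N + 1) → ℤ) = w := rfl
    rw [mulVecLin_apply, one_sub_A1_mulVec, hw]

lemma iotaA1_apply {N : ℕ} [NeZero N] (A : Matrix (Fin N) (Fin N) ℤ) (m : ℤ) :
    iotaA1 A m = (colSpan (1 - A1 A)).mkQ (Fin.cons 0 ((1 - A).mulVec (m • e1 N))) :=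
  rfl

lemma sA_smul_e1 {N : ℕ} [NeZero N] (m : ℤ) : sA N (m • e1 N) = m := by
  rw [map_smul, sA_e1, smul_eq_mul, mul_one]

lemma exact_inclKer_sRes {N : ℕ} [NeZero N] (A : Matrix (Fin N) (Fin N) ℤ) :
    Function.Exact (inclKer A) (sRes A) := by
  intro x
  constructor
  · intro hx
    exact ⟨⟨x.1, x.2, hx⟩, rfl⟩
  · rintro ⟨z, rfl⟩
    exact z.2.2

lemma exact_sRes_iotaA1 {N : ℕ} [NeZero N] (A : Matrix (Fin N) (Fin N) ℤ) :
    Function.Exact (sRes A) (iotaA1 A) := by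
  intro m
  rw [iotaA1_apply, Submodule.mkQ_apply, Submodule.Quotient.mk_eq_zero,
    cons_mem_colSpan_one_sub_A1]
  constructor
  · rintro ⟨w, hs, hw⟩
    refine ⟨⟨m • e1 N - w, ?_⟩, ?_⟩
    · rw [LinearMap.mem_ker, mulVecLin_apply, Matrix.mulVec_sub, hw, sub_self]
    · change sA N (m • e1 N - w) = m
      rw [map_sub, sA_smul_e1, neg_eq_zero.1 hs, sub_zero]
  · rintro ⟨⟨x, hx⟩, hm⟩
    change sA N x = m at hm
    rw [LinearMap.mem_ker, mulVecLin_apply] at hx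
    refine ⟨m • e1 N - x, ?_, ?_⟩
    · rw [map_sub, sA_smul_e1, hm, sub_self, neg_zero]
    · rw [Matrix.mulVec_sub, hx, sub_zero]

lemma exact_iotaA1_qA1 {N : ℕ} [NeZero N] (A : Matrix (Fin N) (Fin N) ℤ) :
    Function.Exact (iotaA1 A) (qA1 A) := by
  intro z
  obtain ⟨v, rfl⟩ := Submodule.mkQ_surjective _ z
  constructor
  · intro hz
    obtain ⟨k, hk⟩ : tailL v ∈ colSpan (1 - A) := (Submodule.Quotient.mk_eq_zero _).1 hz
    rw [mulVecLin_apply] at hk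
    refine ⟨sA N k + v 0, ?_⟩
    rw [iotaA1_apply, Submodule.mkQ_apply, Submodule.mkQ_apply, Submodule.Quotient.eq]
    have hd : (Fin.cons 0 ((1 - A).mulVec ((sA N k + v 0) • e1 N)) : Fin (N + 1) → ℤ) - v =
        Fin.cons (-v 0) ((1 - A).mulVec ((sA N k + v 0) • e1 N - k)) := by
      rw [Matrix.mulVec_sub, hk]
      funext i
      refine Fin.cases ?_ (fun i' => ?_) i
      · simp
      · simp [tailL, LinearMap.funLeft_apply]
    rw [hd, cons_mem_colSpan_one_sub_A1]
    refine ⟨_, ?_, rfl⟩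
    rw [map_sub, sA_smul_e1, add_sub_cancel_left]
  · rintro ⟨m, hm⟩
    rw [← hm]
    exact (Submodule.Quotient.mk_eq_zero _).2 ⟨m • e1 N, rfl⟩

lemma qA1_surjective {N : ℕ} (A : Matrix (Fin N) (Fin N) ℤ) :
    Function.Surjective (qA1 A) := by
  intro z
  obtain ⟨v, rfl⟩ := Submodule.mkQ_surjective _ z
  exact ⟨(colSpan (1 - A1 A)).mkQ (ext0 v), rfl⟩

/-- Exactness of
`0 → {x ∈ Ker(I-A) : s_A(x)=0} → Ker(I-A) → ℤ → ℤ^{N+1}/(I-A₁)ℤ^{N+1} → ℤ^N/(I-A)ℤ^N → 0`,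
where the maps are the inclusion, the restriction of `s_A`, `ι_{A₁}`, and `q_{A₁}`. -/
theorem stmt1 (N : ℕ) [NeZero N] (A : Matrix (Fin N) (Fin N) ℤ)
    (h01 : ZeroOneEntries A) (hirr : IsIrreducibleMatrix A)
    (hnp : ¬ IsPermutationMatrix A) :
    Function.Injective (inclKer A) ∧
    Function.Exact (inclKer A) (sRes A) ∧
    Function.Exact (sRes A) (iotaA1 A) ∧
    Function.Exact (iotaA1 A) (qA1 A) ∧
    Function.Surjective (qA1 A) :=
  ⟨Submodule.inclusion_injective _, exact_inclKer_sRes A, exact_sRes_iotaA1 A,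
    exact_iotaA1_qA1 A, qA1_surjective A⟩

end
end

section
/- Let N ≥ 1 and let A be an N×N matrix with entries in {0,1}, regarded as an integer matrix, and assume A is irreducible and not a permutation matrix. Then j_A maps Ker(I−Â) into Ker(I−A), j_A vanishes on i_1(ℤ) ⊆ Ker(I−Â), and the induced homomorphism from Ker(I−Â)/i_1(ℤ) to {x ∈ Ker(I−A) : s_A(x) = 0} is an isomorphism of abelian groups. -/
open Matrix

noncomputable section

/-- The subgroup `i₁(ℤ)` of `Ker(I-Â)`. -/
def i1Range {N : ℕ} [NeZero N] (A : Matrix (Fin N) (Fin N) ℤ) :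
    Submodule ℤ (kerM (1 - Ahat A)) :=
  Submodule.span ℤ {⟨e1 N, e1_mem_kerHat A⟩}

/-- `j_A` restricted to a map `Ker(I-Â) → Ker(I-A)`. -/
def jRes {N : ℕ} [NeZero N] (A : Matrix (Fin N) (Fin N) ℤ) :
    kerM (1 - Ahat A) →ₗ[ℤ] kerM (1 - A) :=
  (jA N).restrict fun x hx => jA_mem_ker A x hx

lemma i1Range_le_ker_jRes {N : ℕ} [NeZero N] (A : Matrix (Fin N) (Fin N) ℤ) :
    i1Range A ≤ LinearMap.ker (jRes A) :=
  Submodule.span_le.mpr (Set.singleton_subset_iff.mpr (by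
    rw [SetLike.mem_coe, LinearMap.mem_ker]
    exact Subtype.ext (by simp [jRes, LinearMap.restrict_apply, jA_e1])))

/-- The homomorphism `Ker(I-Â)/i₁(ℤ) → Ker(I-A)` induced by `j_A`. -/
def jBar {N : ℕ} [NeZero N] (A : Matrix (Fin N) (Fin N) ℤ) :
    (kerM (1 - Ahat A) ⧸ i1Range A) →ₗ[ℤ] kerM (1 - A) :=
  Submodule.liftQ _ (jRes A) (i1Range_le_ker_jRes A)

lemma jA_mem_ker_inf {N : ℕ} [NeZero N] (A : Matrix (Fin N) (Fin N) ℤ) :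
    ∀ x ∈ kerM (1 - Ahat A), jA N x ∈ kerM (1 - A) ⊓ LinearMap.ker (sA N) :=
  fun x hx => ⟨jA_mem_ker A x hx, sA_jA x⟩

/-- The homomorphism `Ker(I-Â)/i₁(ℤ) → {x ∈ Ker(I-A) : s_A(x) = 0}` induced
by `j_A`. -/
def jBar' {N : ℕ} [NeZero N] (A : Matrix (Fin N) (Fin N) ℤ) :
    (kerM (1 - Ahat A) ⧸ i1Range A) →ₗ[ℤ] ↥(kerM (1 - A) ⊓ LinearMap.ker (sA N)) :=
  Submodule.liftQ _ ((jA N).restrict (jA_mem_ker_inf A))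
    (Submodule.span_le.mpr (Set.singleton_subset_iff.mpr (by
      rw [SetLike.mem_coe, LinearMap.mem_ker]
      exact Subtype.ext (by simp [LinearMap.restrict_apply, jA_e1]))))

/-- `j_A` maps `Ker(I-Â)` into `Ker(I-A)`, vanishes on `i₁(ℤ)`, and induces an
isomorphism of abelian groups `Ker(I-Â)/i₁(ℤ) ≅ {x ∈ Ker(I-A) : s_A(x) = 0}`. -/
theorem stmt3 (N : ℕ) [NeZero N] (A : Matrix (Fin N) (Fin N) ℤ)
    (h01 : ZeroOneEntries A) (hirr : IsIrreducibleMatrix A)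
    (hnp : ¬ IsPermutationMatrix A) :
    (∀ x ∈ kerM (1 - Ahat A), jA N x ∈ kerM (1 - A)) ∧
    (∀ m : ℤ, jA N (i1 N m) = 0) ∧
    Function.Bijective (jBar' A) := by
  refine ⟨jA_mem_ker A, fun m => ?_, ?_, ?_⟩
  · rw [i1, LinearMap.toSpanSingleton_apply, map_smul, jA_e1, smul_zero]
  · rw [← LinearMap.ker_eq_bot]
    refine Submodule.ker_liftQ_eq_bot _ _ _ fun x hx => ?_
    have h : jA N x = 0 := congrArg Subtype.val (LinearMap.mem_ker.mp hx)
    rw [jA_eq', sub_eq_zero] at h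
    exact Submodule.mem_span_singleton.mpr ⟨sA N x, Subtype.ext h.symm⟩
  · rintro ⟨y, hy, hs⟩
    have hj : jA N y = y := by
      rw [jA_eq', LinearMap.mem_ker.mp hs, zero_smul, sub_zero]
    have hy' : y ∈ kerM (1 - Ahat A) := by
      rw [LinearMap.mem_ker, mulVecLin_apply, one_sub_Ahat, ← Matrix.mulVec_mulVec,
        ← jA_eq_mulVec, hj]
      exact LinearMap.mem_ker.mp hy
    exact ⟨Submodule.Quotient.mk ⟨y, hy'⟩, Subtype.ext hj⟩

end
end

section
/- Let A = [[1,1,1],[1,1,1],[1,0,0]] and let B = A^t = [[1,1,1],[1,1,0],[1,1,0]]. Then the abelian groups ℤ^4/(I−A_1)ℤ^4 and ℤ^4/(I−B_1)ℤ^4 are not isomorphic (the first is isomorphic to ℤ while the second is isomorphic to ℤ ⊕ ℤ/2ℤ). -/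
open Matrix

noncomputable section

/-- A surjection from `ℤ^N` whose kernel is `Mℤ^N` identifies `ℤ^N / Mℤ^N` with its target. -/
def MQuotEquivOfKerEq {N : ℕ} {G : Type*} [AddCommGroup G] {M : Matrix (Fin N) (Fin N) ℤ}
    (f : (Fin N → ℤ) →ₗ[ℤ] G) (hker : colSpan M = LinearMap.ker f)
    (hsurj : Function.Surjective f) : MQuot M ≃+ G :=
  ((Submodule.quotEquivOfEq _ _ hker).trans
    (f.quotKerEquivOfSurjective hsurj)).toAddEquiv

lemma one_sub_A1_eq :
    1 - A1 !![1, 1, 1; 1, 1, 1; 1, 0, (0 : ℤ)] =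
      !![0, -1, -1, -1; 0, 0, -1, -1; 0, -1, 0, -1; 0, -1, 0, 1] := by
  decide

lemma one_sub_A1_transpose_eq :
    1 - A1 (!![1, 1, 1; 1, 1, 1; 1, 0, (0 : ℤ)]ᵀ) =
      !![0, -1, -1, -1; 0, 0, -1, -1; 0, -1, 0, 0; 0, -1, -1, 1] := by
  decide

lemma mem_colSpan_one_sub_A1_iff (y : Fin 4 → ℤ) :
    y ∈ colSpan (1 - A1 !![1, 1, 1; 1, 1, 1; 1, 0, (0 : ℤ)]) ↔
      -2 * y 0 + 2 * y 1 + y 2 + y 3 = 0 := by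
  rw [one_sub_A1_eq]
  constructor
  · rintro ⟨x, rfl⟩
    simp [Matrix.mulVec, dotProduct, Fin.sum_univ_four]
    ring
  · intro h
    refine ⟨![0, y 1 - y 0, y 0 - 2 * y 1 - y 3, y 3 + y 1 - y 0], ?_⟩
    funext i
    fin_cases i <;>
      simp [Matrix.mulVec, dotProduct, Fin.sum_univ_four] <;>
      linarith

lemma mem_colSpan_one_sub_A1_transpose_iff (y : Fin 4 → ℤ) :
    y ∈ colSpan (1 - A1 (!![1, 1, 1; 1, 1, 1; 1, 0, (0 : ℤ)]ᵀ)) ↔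
      y 0 - y 1 - y 2 = 0 ∧ (2 : ℤ) ∣ y 1 + y 2 + y 3 := by
  rw [one_sub_A1_transpose_eq]
  constructor
  · rintro ⟨x, rfl⟩
    simp [Matrix.mulVec, dotProduct, Fin.sum_univ_four]
    omega
  · rintro ⟨h, k, hk⟩
    refine ⟨![0, -y 2, y 2 - k, k - y 1 - y 2], ?_⟩
    funext i
    fin_cases i <;>
      simp [Matrix.mulVec, dotProduct, Fin.sum_univ_four] <;>
      linarith

/-- `ℤ⁴/(I-A₁)ℤ⁴ ≃ ℤ`, induced by `y ↦ -2y₀ + 2y₁ + y₂ + y₃`. -/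
def MQuotA1Equiv : MQuot (1 - A1 !![1, 1, 1; 1, 1, 1; 1, 0, (0 : ℤ)]) ≃+ ℤ :=
  MQuotEquivOfKerEq
    (AddMonoidHom.mk' (fun y : Fin 4 → ℤ => -2 * y 0 + 2 * y 1 + y 2 + y 3)
      (fun a b => by simp only [Pi.add_apply]; ring)).toIntLinearMap
    (by
      ext y
      rw [mem_colSpan_one_sub_A1_iff]
      rfl)
    (fun n => ⟨![0, 0, 0, n], by simp⟩)

/-- `ℤ⁴/(I-B₁)ℤ⁴ ≃ ℤ ⊕ ℤ/2ℤ` for `B = Aᵗ`, induced by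
`y ↦ (y₀ - y₁ - y₂, y₁ + y₂ + y₃ mod 2)`. -/
def MQuotA1TransposeEquiv :
    MQuot (1 - A1 (!![1, 1, 1; 1, 1, 1; 1, 0, (0 : ℤ)]ᵀ)) ≃+ ℤ × ZMod 2 :=
  MQuotEquivOfKerEq
    (AddMonoidHom.mk'
      (fun y : Fin 4 → ℤ => (y 0 - y 1 - y 2, ((y 1 + y 2 + y 3 : ℤ) : ZMod 2)))
      (fun a b => by
        ext
        · simp only [Pi.add_apply, Prod.fst_add]; ring
        · simp only [Pi.add_apply, Prod.snd_add]; push_cast; ring)).toIntLinearMap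
    (by
      ext y
      rw [mem_colSpan_one_sub_A1_transpose_iff, LinearMap.mem_ker,
        AddMonoidHom.coe_toIntLinearMap, AddMonoidHom.mk'_apply, Prod.mk_eq_zero,
        ZMod.intCast_zmod_eq_zero_iff_dvd]
      rfl)
    (fun ⟨n, z⟩ => by
      obtain ⟨k, rfl⟩ := ZMod.intCast_surjective z
      exact ⟨![n, 0, 0, k], by simp⟩)

lemma isEmpty_int_addEquiv_int_prod_zmod_two : IsEmpty (ℤ ≃+ ℤ × ZMod 2) := by
  refine ⟨fun e => ?_⟩
  have htwo : (2 : ℕ) • ((0, 1) : ℤ × ZMod 2) = 0 := by decide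
  have hzero : e.symm (0, 1) = 0 := by
    have h := map_nsmul e.symm 2 (0, 1)
    rw [htwo, map_zero] at h
    simpa using h.symm
  rw [e.symm.map_eq_zero_iff] at hzero
  simp at hzero

/-- For `A = [[1,1,1],[1,1,1],[1,0,0]]` and `B = Aᵗ = [[1,1,1],[1,1,0],[1,1,0]]`, the
abelian groups `ℤ⁴/(I-A₁)ℤ⁴` and `ℤ⁴/(I-B₁)ℤ⁴` are not isomorphic: the first is
isomorphic to `ℤ` and the second to `ℤ ⊕ ℤ/2ℤ`. -/
theorem stmt16 :
    IsEmpty (MQuot (1 - A1 !![1, 1, 1; 1, 1, 1; 1, 0, (0 : ℤ)]) ≃+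
             MQuot (1 - A1 (!![1, 1, 1; 1, 1, 1; 1, 0, (0 : ℤ)]ᵀ))) ∧
    Nonempty (MQuot (1 - A1 !![1, 1, 1; 1, 1, 1; 1, 0, (0 : ℤ)]) ≃+ ℤ) ∧
    Nonempty (MQuot (1 - A1 (!![1, 1, 1; 1, 1, 1; 1, 0, (0 : ℤ)]ᵀ)) ≃+ ℤ × ZMod 2) := by
  refine ⟨⟨fun e => ?_⟩, ⟨MQuotA1Equiv⟩, ⟨MQuotA1TransposeEquiv⟩⟩
  exact isEmpty_int_addEquiv_int_prod_zmod_two.false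
    ((MQuotA1Equiv.symm.trans e).trans MQuotA1TransposeEquiv)

end
end
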